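/- Let P : g → g be ad-equivariant and let h, e ∈ g satisfy [h, e] = 2e. Then for every integer k ≥ 0: [h, dᵏP(h).e⁽ᵏ⁾] = 2k·dᵏP(h).e⁽ᵏ⁾, i.e. dᵏP(h).e⁽ᵏ⁾ is an eigenvector of ad h with eigenvalue 2k (or zero). -/

import Mathlib

/-- Along an affine line, the diagonal `k`-th derivative has the diagonal `(k + 1)`-st derivative
as its derivative. -/
theorem hasDerivAt_iteratedFDeriv_line {𝕜 E F : Type*} [NontriviallyNormedField 𝕜]
    [NormedAddCommGroup E] [NormedSpace 𝕜 E] [NormedAddCommGroup F] [NormedSpace 𝕜 F]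
    {f : E → F} {k : ℕ} (hf : ContDiff 𝕜 (k + 1) f) (x v : E) (t : 𝕜) :
    HasDerivAt (fun s : 𝕜 => iteratedFDeriv 𝕜 k f (x + s • v) (fun _ => v))
      (iteratedFDeriv 𝕜 (k + 1) f (x + t • v) (fun _ => v)) t := by
  have hline : HasDerivAt (fun s : 𝕜 => x + s • v) v t := by
    simpa using ((hasDerivAt_id t).smul_const v).const_add x
  have hdiff : DifferentiableAt 𝕜 (iteratedFDeriv 𝕜 k f) (x + t • v) :=
    hf.differentiable_iteratedFDeriv (by exact_mod_cast Nat.lt_succ_self k) _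
  have hcomp := hdiff.hasFDerivAt.comp_hasDerivAt t hline
  exact (ContinuousMultilinearMap.apply 𝕜 (fun _ : Fin k => E) F
    (fun _ => v)).hasFDerivAt.comp_hasDerivAt t hcomp

theorem stmt {g : Type*} [NormedAddCommGroup g] [NormedSpace ℂ g] [FiniteDimensional ℂ g]
    -- `lie` is the Lie bracket of the finite-dimensional complex Lie algebra `g`,
    -- given as bilinear data so that it is compatible with the normed space structure.
    (lie : g →ₗ[ℂ] g →ₗ[ℂ] g)
    (lie_self : ∀ x : g, lie x x = 0)
    (lie_jacobi : ∀ x y z : g, lie x (lie y z) = lie (lie x y) z + lie y (lie x z))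
    (P : g → g) (hP : ContDiff ℂ ⊤ P)
    (hPeq : ∀ x y : g, fderiv ℂ P x (lie y x) = lie y (P x))
    (h e : g) (hhe : lie h e = (2 : ℂ) • e)
    (k : ℕ) :
    lie h (iteratedFDeriv ℂ k P h (fun _ => e))
      = (2 * (k : ℂ)) • iteratedFDeriv ℂ k P h (fun _ => e) := by
  set F : ℕ → ℂ → g := fun k t => iteratedFDeriv ℂ k P (h + t • e) (fun _ => e) with hF
  have hderiv (k : ℕ) (t : ℂ) : HasDerivAt (F k) (F (k + 1) t) t :=
    hasDerivAt_iteratedFDeriv_line (hP.of_le le_top) h e t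
  have key (k : ℕ) : ∀ t : ℂ, lie h (F k t) = (2 * t) • F (k + 1) t + (2 * (k : ℂ)) • F k t := by
    induction k with
    | zero =>
      intro t
      have heq := hPeq (h + t • e) h
      simp only [map_add, map_smul, lie_self, hhe, zero_add] at heq
      simp [hF, ← heq, mul_smul, smul_comm t (2 : ℂ)]
    | succ k ih =>
      intro t
      have hleft : HasDerivAt (fun s => lie h (F k s)) (lie h (F (k + 1) t)) t :=
        (lie h).toContinuousLinearMap.hasFDerivAt.comp_hasDerivAt t (hderiv k t)
      have hright := (((hasDerivAt_id t).const_mul (2 : ℂ)).smul (hderiv (k + 1) t)).add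
        ((hderiv k t).const_smul (2 * (k : ℂ)))
      rw [funext ih] at hleft
      rw [hleft.unique hright]
      push_cast
      simp only [id]
      module
  simpa [hF] using key k 0
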